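/- Coercivity of 𝓛_Γ^T with one angular derivative: for every α ∈ (0,1] and every admissible f, with γ = 1 + α/10, (D_θ(𝓛_Γ^T(f)), (D_θ f)·w²/sin(2θ)^γ)_{L²} ≥ (1/4 − α)·‖(D_θ f)·w/sin(2θ)^{γ/2}‖²_{L²} − 10⁷·α·‖f·w‖²_{L²}. -/

import Mathlib

open Real MeasureTheory Set Filter

noncomputable section

/-- The angular kernel `K(θ) = 3 sin θ cos² θ`. -/
def Kker (θ : ℝ) : ℝ := 3 * Real.sin θ * Real.cos θ ^ 2

/-- `L₁₂(f)(z) = ∫_z^∞ ∫_0^{π/2} f(r,θ) K(θ)/r dθ dr`. -/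
def L12 (f : ℝ → ℝ → ℝ) (z : ℝ) : ℝ :=
  ∫ r in Ioi z, ∫ θ in Icc 0 (π / 2), f r θ * Kker θ / r

/-- The radial weight `w(z) = (1+z)²/z²`. -/
def wgt (z : ℝ) : ℝ := (1 + z) ^ 2 / z ^ 2

/-- `D_θ f = sin(2θ) ∂_θ f`. -/
def Dth (f : ℝ → ℝ → ℝ) (z θ : ℝ) : ℝ := Real.sin (2 * θ) * deriv (fun t => f z t) θ

/-- `D_z f = z ∂_z f`. -/
def Dzr (f : ℝ → ℝ → ℝ) (z θ : ℝ) : ℝ := z * deriv (fun s => f s θ) z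

/-- `Γ(θ) = (sin θ cos² θ)^{α/3}`. -/
def Gam (α θ : ℝ) : ℝ := (Real.sin θ * Real.cos θ ^ 2) ^ (α / 3)

/-- `c = ∫_0^{π/2} Γ(θ) K(θ) dθ`. -/
def cGam (α : ℝ) : ℝ := ∫ θ in Icc 0 (π / 2), Gam α θ * Kker θ

/-- `𝓛(f) = f + z ∂_z f - 2 f/(1+z)`. -/
def Lop (f : ℝ → ℝ → ℝ) (z θ : ℝ) : ℝ :=
  f z θ + z * deriv (fun s => f s θ) z - 2 * f z θ / (1 + z)

/-- `𝓛_Γ(f) = 𝓛(f) - (2zΓ(θ)/(c(1+z)²)) L₁₂(f)`. -/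
def LGam (α : ℝ) (f : ℝ → ℝ → ℝ) (z θ : ℝ) : ℝ :=
  Lop f z θ - 2 * z * Gam α θ / (cGam α * (1 + z) ^ 2) * L12 f z

/-- `ℙ(f)(z,θ) = f(z,θ) - (Γ(θ)/c)(2z²/(1+z)³) L₁₂(f)(0)`. -/
def Pproj (α : ℝ) (f : ℝ → ℝ → ℝ) (z θ : ℝ) : ℝ :=
  f z θ - Gam α θ / cGam α * (2 * z ^ 2 / (1 + z) ^ 3) * L12 f 0

/-- `𝓛_Γ^T(f) = 𝓛_Γ(f) - ℙ((3/(1+z)) D_θ f)`. -/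
def LGamT (α : ℝ) (f : ℝ → ℝ → ℝ) (z θ : ℝ) : ℝ :=
  LGam α f z θ - Pproj α (fun z2 θ2 => 3 / (1 + z2) * Dth f z2 θ2) z θ

/-- The `L²` inner product on `[0,∞) × [0,π/2]` with respect to `dz dθ`. -/
def ip (A B : ℝ → ℝ → ℝ) : ℝ :=
  ∫ z in Ioi (0 : ℝ), ∫ θ in Icc 0 (π / 2), A z θ * B z θ

/-- `f` is admissible: smooth on `[0,∞) × [0,π/2]` and vanishing for `z` outside a
compact subset of `(0,∞)`. -/
def Admissible (f : ℝ → ℝ → ℝ) : Prop :=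
  ContDiff ℝ (⊤ : ℕ∞) (Function.uncurry f) ∧
  ∃ a b : ℝ, 0 < a ∧ ∀ z θ : ℝ, z ∉ Icc a b → f z θ = 0


/-- The partial derivative in the first variable. -/
def partialZ (F : ℝ → ℝ → ℝ) (z θ : ℝ) : ℝ := fderiv ℝ (Function.uncurry F) (z, θ) (1, 0)

/-- The partial derivative in the second variable. -/
def partialTh (F : ℝ → ℝ → ℝ) (z θ : ℝ) : ℝ := fderiv ℝ (Function.uncurry F) (z, θ) (0, 1)

lemma contDiff_partialZ {F : ℝ → ℝ → ℝ} (hF : ContDiff ℝ (⊤ : ℕ∞) (Function.uncurry F)) :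
    ContDiff ℝ (⊤ : ℕ∞) (Function.uncurry (partialZ F)) :=
  (hF.fderiv_right (m := (⊤ : ℕ∞)) (by simp)).clm_apply contDiff_const

lemma contDiff_partialTh {F : ℝ → ℝ → ℝ} (hF : ContDiff ℝ (⊤ : ℕ∞) (Function.uncurry F)) :
    ContDiff ℝ (⊤ : ℕ∞) (Function.uncurry (partialTh F)) :=
  (hF.fderiv_right (m := (⊤ : ℕ∞)) (by simp)).clm_apply contDiff_const

lemma hasDerivAt_partialZ {F : ℝ → ℝ → ℝ} (hF : ContDiff ℝ (⊤ : ℕ∞) (Function.uncurry F))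
    (z θ : ℝ) : HasDerivAt (fun s => F s θ) (partialZ F z θ) z := by
  have h1 : HasFDerivAt (Function.uncurry F) (fderiv ℝ (Function.uncurry F) (z, θ)) (z, θ) :=
    (hF.differentiable (by simp) _).hasFDerivAt
  exact h1.comp_hasDerivAt z ((hasDerivAt_id z).prodMk (hasDerivAt_const z θ))

lemma hasDerivAt_partialTh {F : ℝ → ℝ → ℝ} (hF : ContDiff ℝ (⊤ : ℕ∞) (Function.uncurry F))
    (z θ : ℝ) : HasDerivAt (fun t => F z t) (partialTh F z θ) θ := by
  have h1 : HasFDerivAt (Function.uncurry F) (fderiv ℝ (Function.uncurry F) (z, θ)) (z, θ) :=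
    (hF.differentiable (by simp) _).hasFDerivAt
  exact h1.comp_hasDerivAt θ ((hasDerivAt_const θ z).prodMk (hasDerivAt_id θ))

lemma partialTh_partialZ {F : ℝ → ℝ → ℝ} (hF : ContDiff ℝ (⊤ : ℕ∞) (Function.uncurry F))
    (z θ : ℝ) : partialTh (partialZ F) z θ = partialZ (partialTh F) z θ := by
  have hs : IsSymmSndFDerivAt ℝ (Function.uncurry F) (z, θ) :=
    hF.contDiffAt.isSymmSndFDerivAt (by
      rw [minSmoothness_of_isRCLikeNormedField]
      exact WithTop.coe_le_coe.2 (le_top : (2 : ℕ∞) ≤ ⊤))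
  have hd : DifferentiableAt ℝ (fderiv ℝ (Function.uncurry F)) (z, θ) :=
    ((hF.fderiv_right (m := (⊤ : ℕ∞)) (by simp)).differentiable (by simp)) _
  have key : ∀ v : ℝ × ℝ, fderiv ℝ (fun x => fderiv ℝ (Function.uncurry F) x v) (z, θ) =
      (fderiv ℝ (fderiv ℝ (Function.uncurry F)) (z, θ)).flip v := by
    intro v
    have := (hd.hasFDerivAt.clm_apply (hasFDerivAt_const v (z, θ))).fderiv
    rw [this]; simp
  have e1 : Function.uncurry (partialZ F) = fun x => fderiv ℝ (Function.uncurry F) x (1, 0) := rfl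
  have e2 : Function.uncurry (partialTh F) = fun x => fderiv ℝ (Function.uncurry F) x (0, 1) := rfl
  rw [partialTh, partialZ, e1, e2, key, key]
  exact hs _ _

/-- Locally in `z`, a jointly continuous function is bounded uniformly for `θ ∈ [0, π/2]`. -/
lemma exists_local_bound {P : ℝ → ℝ → ℝ} (hP : Continuous (Function.uncurry P)) (z : ℝ) :
    ∃ C, ∀ s ∈ Metric.ball z 1, ∀ θ ∈ Icc 0 (π / 2), ‖P s θ‖ ≤ C := by
  obtain ⟨C, hC⟩ := ((isCompact_closedBall z 1).prod
    (isCompact_Icc (a := (0 : ℝ)) (b := π / 2))).exists_bound_of_continuousOn hP.continuousOn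
  exact ⟨C, fun s hs θ hθ => hC (s, θ) ⟨Metric.ball_subset_closedBall hs, hθ⟩⟩

lemma integrable_mul_slice {h : ℝ → ℝ} (hh : IntegrableOn h (Icc 0 (π / 2)))
    {P : ℝ → ℝ → ℝ} (hP : Continuous (Function.uncurry P)) (z : ℝ) :
    IntegrableOn (fun θ => h θ * P z θ) (Icc 0 (π / 2)) :=
  IntegrableOn.mul_continuousOn hh
    (hP.comp (continuous_const.prodMk continuous_id)).continuousOn isCompact_Icc

lemma continuous_integral_mul {h : ℝ → ℝ} (hh : IntegrableOn h (Icc 0 (π / 2)))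
    {P : ℝ → ℝ → ℝ} (hP : Continuous (Function.uncurry P)) :
    Continuous fun z => ∫ θ in Icc 0 (π / 2), h θ * P z θ := by
  rw [continuous_iff_continuousAt]
  intro z
  obtain ⟨C, hC⟩ := exists_local_bound hP z
  refine continuousAt_of_dominated (bound := fun θ => ‖h θ‖ * C) ?_ ?_ (hh.norm.mul_const C) ?_
  · exact Eventually.of_forall fun s => (integrable_mul_slice hh hP s).aestronglyMeasurable
  · filter_upwards [Metric.ball_mem_nhds z one_pos] with s hs
    filter_upwards [ae_restrict_mem measurableSet_Icc] with θ hθ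
    rw [norm_mul]
    exact mul_le_mul_of_nonneg_left (hC s hs θ hθ) (norm_nonneg _)
  · refine Eventually.of_forall fun θ => ?_
    exact (continuous_const.mul (hP.comp (continuous_id.prodMk continuous_const))).continuousAt

lemma hasDerivAt_integral_mul {h : ℝ → ℝ} (hh : IntegrableOn h (Icc 0 (π / 2)))
    {P : ℝ → ℝ → ℝ} (hP : ContDiff ℝ (⊤ : ℕ∞) (Function.uncurry P)) (z : ℝ) :
    HasDerivAt (fun z => ∫ θ in Icc 0 (π / 2), h θ * P z θ)
      (∫ θ in Icc 0 (π / 2), h θ * partialZ P z θ) z := by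
  have hc := (contDiff_partialZ hP).continuous
  obtain ⟨C, hC⟩ := exists_local_bound hc z
  refine (hasDerivAt_integral_of_dominated_loc_of_deriv_le (bound := fun θ => ‖h θ‖ * C)
    (F := fun s θ => h θ * P s θ) (F' := fun s θ => h θ * partialZ P s θ)
    (Metric.ball_mem_nhds z one_pos) ?_ ?_ ?_ ?_ (hh.norm.mul_const C) ?_).2
  · exact Eventually.of_forall fun s =>
      (integrable_mul_slice hh hP.continuous s).aestronglyMeasurable
  · exact integrable_mul_slice hh hP.continuous z
  · exact (integrable_mul_slice hh hc z).aestronglyMeasurable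
  · filter_upwards [ae_restrict_mem measurableSet_Icc] with θ hθ s hs
    rw [norm_mul]
    exact mul_le_mul_of_nonneg_left (hC s hs θ hθ) (norm_nonneg _)
  · exact Eventually.of_forall fun θ s _ => (hasDerivAt_partialZ hP s θ).const_mul _

/-- The Cauchy–Schwarz inequality for real integrals. -/
lemma sq_integral_mul_le {X : Type*} [MeasurableSpace X] {μ : Measure X} {f g : X → ℝ}
    (hf : Integrable (fun x => f x ^ 2) μ) (hg : Integrable (fun x => g x ^ 2) μ)
    (hfg : Integrable (fun x => f x * g x) μ) :
    (∫ x, f x * g x ∂μ) ^ 2 ≤ (∫ x, f x ^ 2 ∂μ) * ∫ x, g x ^ 2 ∂μ := by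
  have key : ∀ t : ℝ, 0 ≤ (∫ x, f x ^ 2 ∂μ) * (t * t) + (2 * ∫ x, f x * g x ∂μ) * t +
      ∫ x, g x ^ 2 ∂μ := by
    intro t
    have h0 : 0 ≤ ∫ x, (f x * t + g x) ^ 2 ∂μ := integral_nonneg fun x => sq_nonneg _
    have h1 : ∫ x, (f x * t + g x) ^ 2 ∂μ =
        ∫ x, (f x ^ 2 * (t * t) + f x * g x * (2 * t) + g x ^ 2) ∂μ :=
      integral_congr_ae (Eventually.of_forall fun x => by simp only; ring)
    have h2 : Integrable (fun x => f x ^ 2 * (t * t) + f x * g x * (2 * t)) μ :=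
      (hf.mul_const _).add (hfg.mul_const _)
    rw [h1, integral_add h2 hg,
      integral_add (hf.mul_const _) (hfg.mul_const _), integral_mul_const,
      integral_mul_const] at h0
    linarith
  have := discrim_le_zero key
  rw [discrim] at this
  linarith

lemma ae_mem_Ioo : ∀ᵐ θ ∂(volume.restrict (Icc 0 (π / 2))), θ ∈ Ioo 0 (π / 2) := by
  rw [← restrict_Ioo_eq_restrict_Icc]
  exact ae_restrict_mem measurableSet_Ioo

lemma sin_cos_pos {θ : ℝ} (h : θ ∈ Ioo 0 (π / 2)) : 0 < sin θ ∧ 0 < cos θ :=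
  ⟨sin_pos_of_pos_of_lt_pi h.1 (by linarith [h.2, pi_pos]),
    cos_pos_of_mem_Ioo ⟨by linarith [h.1, pi_pos], h.2⟩⟩

lemma integral_Icc_eq_sub {F F' : ℝ → ℝ} (hc : ContinuousOn F (Icc 0 (π / 2)))
    (hd : ∀ θ ∈ Ioo 0 (π / 2), HasDerivAt F (F' θ) θ)
    (hi : IntegrableOn F' (Icc 0 (π / 2))) :
    ∫ θ in Icc 0 (π / 2), F' θ = F (π / 2) - F 0 := by
  have hpi : (0 : ℝ) ≤ π / 2 := by positivity
  rw [integral_Icc_eq_integral_Ioc, ← intervalIntegral.integral_of_le hpi]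
  exact intervalIntegral.integral_eq_sub_of_hasDerivAt_of_le hpi hc hd
    ((intervalIntegrable_iff_integrableOn_Icc_of_le hpi).2 hi)

lemma integrableOn_Icc_of_hasDerivAt_nonneg {F F' : ℝ → ℝ} (hc : ContinuousOn F (Icc 0 (π / 2)))
    (hd : ∀ θ ∈ Ioo 0 (π / 2), HasDerivAt F (F' θ) θ)
    (hp : ∀ θ ∈ Ioo 0 (π / 2), 0 ≤ F' θ) :
    IntegrableOn F' (Icc 0 (π / 2)) := by
  rw [integrableOn_Icc_iff_integrableOn_Ioc]
  exact intervalIntegral.integrableOn_deriv_of_nonneg hc hd hp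

/-- The integrand `sin^{β-1} cos + cos^{β-1} sin`. -/
def betaBound (β θ : ℝ) : ℝ := sin θ ^ (β - 1) * cos θ + cos θ ^ (β - 1) * sin θ

lemma integral_betaBound {β : ℝ} (hβ : 0 < β) :
    IntegrableOn (betaBound β) (Icc 0 (π / 2)) ∧
      ∫ θ in Icc 0 (π / 2), betaBound β θ = 2 / β := by
  have hc : ContinuousOn (fun θ => sin θ ^ β / β - cos θ ^ β / β) (Icc 0 (π / 2)) :=
    (((continuous_sin.rpow_const fun _ => Or.inr hβ.le).div_const β).sub
      ((continuous_cos.rpow_const fun _ => Or.inr hβ.le).div_const β)).continuousOn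
  have hd : ∀ θ ∈ Ioo 0 (π / 2),
      HasDerivAt (fun θ => sin θ ^ β / β - cos θ ^ β / β) (betaBound β θ) θ := by
    intro θ hθ
    obtain ⟨hs, hk⟩ := sin_cos_pos hθ
    have h1 := ((hasDerivAt_sin θ).rpow_const (p := β) (Or.inl hs.ne')).div_const β
    have h2 := ((hasDerivAt_cos θ).rpow_const (p := β) (Or.inl hk.ne')).div_const β
    refine (h1.sub h2).congr_deriv ?_
    rw [betaBound]
    field_simp
    ring
  have hi := integrableOn_Icc_of_hasDerivAt_nonneg hc hd fun θ hθ => by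
    obtain ⟨hs, hk⟩ := sin_cos_pos hθ
    rw [betaBound]; positivity
  refine ⟨hi, ?_⟩
  rw [integral_Icc_eq_sub hc hd hi]
  simp [zero_rpow hβ.ne']
  ring

/-- The derivative of `Γ` on `(0, π/2)`. -/
def derivGam (α θ : ℝ) : ℝ :=
  α / 3 * (sin θ * cos θ ^ 2) ^ (α / 3 - 1) * (cos θ ^ 3 - 2 * sin θ ^ 2 * cos θ)

lemma hasDerivAt_Gam (α : ℝ) {θ : ℝ} (hθ : θ ∈ Ioo 0 (π / 2)) :
    HasDerivAt (Gam α) (derivGam α θ) θ := by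
  obtain ⟨hs, hk⟩ := sin_cos_pos hθ
  have h1 := ((hasDerivAt_sin θ).mul ((hasDerivAt_cos θ).pow 2)).rpow_const (p := α / 3)
    (Or.inl (by simp only [Pi.mul_apply, Pi.pow_apply]; positivity))
  refine h1.congr_deriv ?_
  simp only [derivGam, Pi.mul_apply, Pi.pow_apply]
  push_cast
  ring

/-- The angular weight `sin(2θ)^{1-α/10} = sin(2θ)^{2-γ}`. -/
def angWeight (α θ : ℝ) : ℝ := sin (2 * θ) ^ (1 - α / 10)

lemma continuous_angWeight {α : ℝ} (hα : α ≤ 1) : Continuous (angWeight α) :=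
  (continuous_sin.comp (continuous_const.mul continuous_id)).rpow_const
    fun _ => Or.inr (by linarith)

lemma angWeight_nonneg (α : ℝ) {θ : ℝ} (hθ : θ ∈ Icc 0 (π / 2)) : 0 ≤ angWeight α θ :=
  rpow_nonneg (sin_nonneg_of_nonneg_of_le_pi (by linarith [hθ.1]) (by linarith [hθ.2])) _

lemma angWeight_mul_derivGam_sq_le {α : ℝ} (hα : α ∈ Ioc (0 : ℝ) 1) {θ : ℝ}
    (hθ : θ ∈ Ioo 0 (π / 2)) :
    angWeight α θ * derivGam α θ ^ 2 ≤ 8 * α ^ 2 / 9 * betaBound (17 * α / 30) θ := by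
  obtain ⟨hα0, hα1⟩ := hα
  obtain ⟨hs, hk⟩ := sin_cos_pos hθ
  have hsc := sin_sq_add_cos_sq θ
  rw [angWeight, derivGam, betaBound, sin_two_mul]
  set u := sin θ
  set v := cos θ
  have hu1 : u ≤ 1 := sin_le_one θ
  have hv1 : v ≤ 1 := cos_le_one θ
  have huv : 0 < u * v := mul_pos hs hk
  have e1 : (2 * u * v) ^ (1 - α / 10) ≤ 2 * (u * v) ^ (1 - α / 10) := by
    rw [mul_assoc, mul_rpow (by norm_num) huv.le]
    gcongr
    calc (2 : ℝ) ^ (1 - α / 10) ≤ 2 ^ (1 : ℝ) :=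
          rpow_le_rpow_of_exponent_le (by norm_num) (by linarith)
      _ = 2 := rpow_one 2
  have e2 : (u * v ^ 2) ^ (α / 3 - 1) = (u * v ^ 2) ^ (α / 3) / (u * v ^ 2) := by
    rw [rpow_sub_one (by positivity)]
  have e3 : (α / 3 * (u * v ^ 2) ^ (α / 3 - 1) * (v ^ 3 - 2 * u ^ 2 * v)) ^ 2 ≤
      4 * α ^ 2 / 9 * ((u * v) ^ (α / 3) / (u * v)) ^ 2 := by
    have : (α / 3 * (u * v ^ 2) ^ (α / 3 - 1) * (v ^ 3 - 2 * u ^ 2 * v)) =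
        α / 3 * ((u * v ^ 2) ^ (α / 3) / (u * v)) * (v ^ 2 - 2 * u ^ 2) := by
      rw [e2]; field_simp
    rw [this, mul_pow]
    have h4 : (v ^ 2 - 2 * u ^ 2) ^ 2 ≤ 4 := by nlinarith [sq_nonneg u, sq_nonneg v]
    have h5 : (u * v ^ 2) ^ (α / 3) ≤ (u * v) ^ (α / 3) :=
      rpow_le_rpow (by positivity) (by nlinarith) (by positivity)
    calc (α / 3 * ((u * v ^ 2) ^ (α / 3) / (u * v))) ^ 2 * (v ^ 2 - 2 * u ^ 2) ^ 2
        ≤ (α / 3 * ((u * v) ^ (α / 3) / (u * v))) ^ 2 * 4 := by gcongr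
      _ = _ := by ring
  have e4 : (u * v) ^ (1 - α / 10) * ((u * v) ^ (α / 3) / (u * v)) ^ 2 =
      (u * v) ^ (17 * α / 30 - 1) := by
    rw [← rpow_sub_one huv.ne', ← rpow_natCast, ← rpow_mul huv.le, ← rpow_add huv]
    congr 1
    push_cast
    ring
  have e5 : (u * v) ^ (17 * α / 30 - 1) ≤
      u ^ (17 * α / 30 - 1) * v + v ^ (17 * α / 30 - 1) * u := by
    rw [mul_rpow hs.le hk.le]
    have key : ∀ x : ℝ, 0 < x → x ≤ 1 → x ^ (17 * α / 30 - 1) * x ^ 2 ≤ x := by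
      intro x hx hx1
      rw [← rpow_natCast, ← rpow_add hx]
      calc x ^ (17 * α / 30 - 1 + (2 : ℕ)) ≤ x ^ (1 : ℝ) :=
            rpow_le_rpow_of_exponent_ge hx hx1 (by push_cast; linarith)
        _ = x := rpow_one x
    have k1 := mul_le_mul_of_nonneg_left (key v hk hv1)
      (rpow_pos_of_pos hs (17 * α / 30 - 1)).le
    have k2 := mul_le_mul_of_nonneg_left (key u hs hu1)
      (rpow_pos_of_pos hk (17 * α / 30 - 1)).le
    calc u ^ (17 * α / 30 - 1) * v ^ (17 * α / 30 - 1)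
        = u ^ (17 * α / 30 - 1) * v ^ (17 * α / 30 - 1) * (u ^ 2 + v ^ 2) := by
          rw [hsc, mul_one]
      _ ≤ _ := by linarith
  calc (2 * u * v) ^ (1 - α / 10) *
        (α / 3 * (u * v ^ 2) ^ (α / 3 - 1) * (v ^ 3 - 2 * u ^ 2 * v)) ^ 2
      ≤ (2 * (u * v) ^ (1 - α / 10)) * (4 * α ^ 2 / 9 * ((u * v) ^ (α / 3) / (u * v)) ^ 2) := by
        gcongr
    _ = 8 * α ^ 2 / 9 * ((u * v) ^ (1 - α / 10) * ((u * v) ^ (α / 3) / (u * v)) ^ 2) := by ring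
    _ ≤ _ := by rw [e4]; gcongr

lemma measurable_derivGam (α : ℝ) : Measurable (derivGam α) := by
  unfold derivGam
  fun_prop

lemma integrableOn_angWeight_mul_derivGam_sq {α : ℝ} (hα : α ∈ Ioc (0 : ℝ) 1) :
    IntegrableOn (fun θ => angWeight α θ * derivGam α θ ^ 2) (Icc 0 (π / 2)) := by
  have hβ : 0 < 17 * α / 30 := by linarith [hα.1]
  refine Integrable.mono' ((integral_betaBound hβ).1.const_mul (8 * α ^ 2 / 9)) ?_ ?_
  · exact ((continuous_angWeight hα.2).measurable.mul
      ((measurable_derivGam α).pow_const 2)).aestronglyMeasurable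
  · filter_upwards [ae_mem_Ioo] with θ hθ
    rw [norm_of_nonneg (mul_nonneg (angWeight_nonneg α (Ioo_subset_Icc_self hθ)) (sq_nonneg _))]
    exact angWeight_mul_derivGam_sq_le hα hθ

lemma integral_angWeight_mul_derivGam_sq_le {α : ℝ} (hα : α ∈ Ioc (0 : ℝ) 1) :
    ∫ θ in Icc 0 (π / 2), angWeight α θ * derivGam α θ ^ 2 ≤ 4 * α := by
  have hα0 := hα.1
  have hβ : 0 < 17 * α / 30 := by linarith [hα.1]
  calc ∫ θ in Icc 0 (π / 2), angWeight α θ * derivGam α θ ^ 2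
      ≤ ∫ θ in Icc 0 (π / 2), 8 * α ^ 2 / 9 * betaBound (17 * α / 30) θ := by
        refine integral_mono_ae (integrableOn_angWeight_mul_derivGam_sq hα)
          ((integral_betaBound hβ).1.const_mul (8 * α ^ 2 / 9)) ?_
        filter_upwards [ae_mem_Ioo] with θ hθ
        exact angWeight_mul_derivGam_sq_le hα hθ
    _ = 8 * α ^ 2 / 9 * (2 / (17 * α / 30)) := by
        rw [integral_const_mul, (integral_betaBound hβ).2]
    _ = 480 / 153 * α := by field_simp; norm_num
    _ ≤ 4 * α := by linarith

lemma integrableOn_angWeight_mul_derivGam {α : ℝ} (hα : α ∈ Ioc (0 : ℝ) 1) :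
    IntegrableOn (fun θ => angWeight α θ * derivGam α θ) (Icc 0 (π / 2)) := by
  refine Integrable.mono' (((continuous_angWeight hα.2).integrableOn_Icc).add
    (integrableOn_angWeight_mul_derivGam_sq hα)) ?_ ?_
  · exact ((continuous_angWeight hα.2).measurable.mul
      (measurable_derivGam α)).aestronglyMeasurable
  · filter_upwards [ae_restrict_mem measurableSet_Icc] with θ hθ
    have h0 := angWeight_nonneg α hθ
    rw [norm_mul, norm_of_nonneg h0, Pi.add_apply, ← mul_one_add]
    gcongr
    rw [norm_eq_abs]
    nlinarith [sq_nonneg (|derivGam α θ| - 1), sq_abs (derivGam α θ), abs_nonneg (derivGam α θ)]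

lemma continuous_Kker : Continuous Kker := by
  unfold Kker
  fun_prop

lemma cGam_ge {α : ℝ} (hα : α ∈ Ioc (0 : ℝ) 1) : 1 / 5 ≤ cGam α := by
  obtain ⟨hα0, hα1⟩ := hα
  have hG : Continuous (Gam α) := by
    unfold Gam
    exact (by fun_prop : Continuous fun θ => sin θ * cos θ ^ 2).rpow_const
      fun _ => Or.inr (by linarith)
  have hi : IntegrableOn (fun θ => 3 * (sin θ ^ 2 * (1 - sin θ ^ 2) ^ 2 * cos θ))
      (Icc 0 (π / 2)) := (by fun_prop : Continuous _).integrableOn_Icc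
  have h1 : ∫ θ in Icc 0 (π / 2), 3 * (sin θ ^ 2 * (1 - sin θ ^ 2) ^ 2 * cos θ) = 8 / 35 := by
    rw [integral_Icc_eq_sub (F := fun θ => sin θ ^ 3 - 6 / 5 * sin θ ^ 5 + 3 / 7 * sin θ ^ 7)
      (by fun_prop) _ hi]
    · simp; norm_num
    · intro θ _
      have h := hasDerivAt_sin θ
      refine (((h.pow 3).sub ((h.pow 5).const_mul (6 / 5))).add
        ((h.pow 7).const_mul (3 / 7))).congr_deriv ?_
      push_cast
      ring
  have h2 : ∫ θ in Icc 0 (π / 2), 3 * (sin θ ^ 2 * (1 - sin θ ^ 2) ^ 2 * cos θ) ≤ cGam α := by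
    refine integral_mono_ae hi (hG.mul continuous_Kker).integrableOn_Icc ?_
    filter_upwards [ae_mem_Ioo] with θ hθ
    obtain ⟨hs, hk⟩ := sin_cos_pos hθ
    have hs1 := sin_le_one θ
    have hk1 := cos_le_one θ
    have hle : sin θ * cos θ ^ 2 ≤ Gam α θ := by
      rw [Gam]
      calc sin θ * cos θ ^ 2 = (sin θ * cos θ ^ 2) ^ (1 : ℝ) := (rpow_one _).symm
        _ ≤ _ := rpow_le_rpow_of_exponent_ge (by positivity) (by nlinarith) (by linarith)
    rw [← cos_sq', Kker]
    calc 3 * (sin θ ^ 2 * (cos θ ^ 2) ^ 2 * cos θ) ≤ 3 * (sin θ ^ 2 * (cos θ ^ 2) ^ 2 * 1) := by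
          gcongr
      _ = sin θ * cos θ ^ 2 * (3 * sin θ * cos θ ^ 2) := by ring
      _ ≤ _ := by gcongr
  linarith

lemma sq_integral_mul_le_of_bound {k g : ℝ → ℝ} {C : ℝ} (hk : Continuous k) (hg : Continuous g)
    (hC : ∀ θ, k θ ^ 2 ≤ C) :
    (∫ θ in Icc 0 (π / 2), k θ * g θ) ^ 2 ≤ 2 * C * ∫ θ in Icc 0 (π / 2), g θ ^ 2 := by
  have hC0 : 0 ≤ C := (sq_nonneg _).trans (hC 0)
  have ik : IntegrableOn (fun θ => k θ ^ 2) (Icc 0 (π / 2)) := (hk.pow 2).integrableOn_Icc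
  have hk2 : ∫ θ in Icc 0 (π / 2), k θ ^ 2 ≤ 2 * C := by
    calc ∫ θ in Icc 0 (π / 2), k θ ^ 2 ≤ ∫ θ in Icc 0 (π / 2), C :=
          integral_mono ik continuous_const.integrableOn_Icc hC
      _ = π / 2 * C := by
          rw [setIntegral_const, smul_eq_mul, Real.volume_real_Icc_of_le (by positivity), sub_zero]
      _ ≤ 2 * C := by
          gcongr
          linarith [pi_le_four]
  refine (sq_integral_mul_le ik (hg.pow 2).integrableOn_Icc
    (hk.mul hg).integrableOn_Icc).trans ?_
  gcongr

/-- A Hardy inequality for `L' = -F/z` with `L` vanishing at both endpoints. -/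
lemma hardy_inequality {a b : ℝ} (ha : 0 < a) (hab : a ≤ b) {L F : ℝ → ℝ}
    (hF : Continuous F) (hL : ∀ z ∈ Icc a b, HasDerivAt L (-(F z / z)) z)
    (hLa : L a = 0) (hLb : L b = 0) :
    ∫ z in a..b, (L z / z) ^ 2 ≤ 4 * ∫ z in a..b, (F z / z) ^ 2 := by
  have hne : ∀ z ∈ Icc a b, z ≠ 0 := fun z hz => (ha.trans_le hz.1).ne'
  have hLc : ContinuousOn L (Icc a b) := fun z hz => (hL z hz).continuousAt.continuousWithinAt
  have hcii : ∀ g : ℝ → ℝ, ContinuousOn g (Icc a b) → IntervalIntegrable g volume a b :=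
    fun g hg => ContinuousOn.intervalIntegrable (by rwa [uIcc_of_le hab])
  have i1 := hcii (fun z => (L z / z) ^ 2) ((hLc.div continuousOn_id hne).pow 2)
  have i2 := hcii (fun z => (F z / z) ^ 2) ((hF.continuousOn.div continuousOn_id hne).pow 2)
  have i3 := hcii (fun z => -(2 * L z * F z + L z ^ 2) / z ^ 2)
    ((((continuousOn_const.mul hLc).mul hF.continuousOn).add (hLc.pow 2)).neg.div
      (continuousOn_id.pow 2) fun z hz => pow_ne_zero 2 (hne z hz))
  have h0 : ∫ z in a..b, -(2 * L z * F z + L z ^ 2) / z ^ 2 = 0 := by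
    rw [intervalIntegral.integral_eq_sub_of_hasDerivAt (f := fun z => L z ^ 2 / z) _ i3]
    · simp [hLa, hLb]
    · intro z hz
      rw [uIcc_of_le hab] at hz
      have hz0 := hne z hz
      refine (((hL z hz).pow 2).div (hasDerivAt_id z) hz0).congr_deriv ?_
      simp only [id, Pi.pow_apply]
      push_cast
      field_simp
      ring
  have h1 : 0 ≤ ∫ z in a..b, (4 * (F z / z) ^ 2 - (L z / z) ^ 2 -
      2 * (-(2 * L z * F z + L z ^ 2) / z ^ 2)) := by
    refine intervalIntegral.integral_nonneg hab fun z hz => ?_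
    have hz0 := hne z hz
    have : 4 * (F z / z) ^ 2 - (L z / z) ^ 2 - 2 * (-(2 * L z * F z + L z ^ 2) / z ^ 2) =
        ((2 * F z + L z) / z) ^ 2 := by
      field_simp
      ring
    rw [this]
    positivity
  rw [intervalIntegral.integral_sub ((i2.const_mul 4).sub i1) (i3.const_mul 2),
    intervalIntegral.integral_sub (i2.const_mul 4) i1, intervalIntegral.integral_const_mul,
    intervalIntegral.integral_const_mul, h0] at h1
  linarith

/-- A smooth function vanishing for `z ∉ (a, b)`, where `0 < a < b`. -/
structure SupportedIn (f : ℝ → ℝ → ℝ) (a b : ℝ) : Prop where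
  smooth : ContDiff ℝ (⊤ : ℕ∞) (Function.uncurry f)
  pos : 0 < a
  lt : a < b
  eq_zero : ∀ z θ, z ∉ Ioo a b → f z θ = 0

lemma Admissible.exists_supportedIn {f : ℝ → ℝ → ℝ} (hf : Admissible f) :
    ∃ a b, SupportedIn f a b := by
  obtain ⟨hs, a, b, ha, h⟩ := hf
  refine ⟨a / 2, max a b + 1, hs, by linarith, by linarith [le_max_left a b], ?_⟩
  intro z θ hz
  refine h z θ fun hz' => hz ⟨by linarith [hz'.1], ?_⟩
  linarith [hz'.2, le_max_right a b]

lemma SupportedIn.partialTh_eq_zero {f : ℝ → ℝ → ℝ} {a b : ℝ} (hf : SupportedIn f a b)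
    {z : ℝ} (hz : z ∉ Ioo a b) (θ : ℝ) : partialTh f z θ = 0 := by
  have h := hasDerivAt_partialTh hf.smooth z θ
  rw [show (fun t => f z t) = fun _ => 0 from funext fun t => hf.eq_zero z t hz] at h
  exact h.unique (hasDerivAt_const θ 0)

lemma Dth_eq {f : ℝ → ℝ → ℝ} (hf : ContDiff ℝ (⊤ : ℕ∞) (Function.uncurry f)) (z θ : ℝ) :
    Dth f z θ = sin (2 * θ) * partialTh f z θ := by
  rw [Dth, (hasDerivAt_partialTh hf z θ).deriv]

/-- An integral over `(c, ∞)` of a function vanishing off `(a, b)`. -/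
lemma setIntegral_Ioi_eq {a b c : ℝ} (hca : c ≤ a) (hab : a ≤ b) {g : ℝ → ℝ}
    (hg : ∀ z, z ∉ Ioo a b → g z = 0) : ∫ z in Ioi c, g z = ∫ z in a..b, g z := by
  rw [intervalIntegral.integral_of_le hab]
  refine setIntegral_eq_of_subset_of_forall_sdiff_eq_zero measurableSet_Ioi
    (fun z hz => lt_of_le_of_lt hca hz.1) fun z hz => hg z fun h => hz.2 ⟨h.1, h.2.le⟩

/-- The angular moment `∫ K f`. -/
def angMoment (f : ℝ → ℝ → ℝ) (z : ℝ) : ℝ := ∫ θ in Icc 0 (π / 2), Kker θ * f z θ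

/-- The angular energy `∫ f²`. -/
def angEnergy (f : ℝ → ℝ → ℝ) (z : ℝ) : ℝ := ∫ θ in Icc 0 (π / 2), f z θ ^ 2

lemma Kker_sq_le (θ : ℝ) : Kker θ ^ 2 ≤ 9 := by
  have hc : cos θ ^ 2 ≤ 1 := cos_sq_le_one θ
  have hs : sin θ ^ 2 ≤ 1 := sin_sq_le_one θ
  calc Kker θ ^ 2 = 9 * (sin θ ^ 2 * (cos θ ^ 2 * cos θ ^ 2)) := by rw [Kker]; ring
    _ ≤ 9 * (1 * (1 * 1)) := by gcongr
    _ = 9 := by norm_num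

lemma continuous_angEnergy {f : ℝ → ℝ → ℝ} (hf : Continuous (Function.uncurry f)) :
    Continuous (angEnergy f) := by
  have hf' : Continuous fun x : ℝ × ℝ => f x.1 x.2 := hf
  have h := continuous_integral_mul (h := fun _ => 1) (P := fun z θ => f z θ ^ 2)
    continuous_const.integrableOn_Icc
    (show Continuous fun x : ℝ × ℝ => f x.1 x.2 ^ 2 by fun_prop)
  simp only [one_mul] at h
  exact h

lemma angEnergy_nonneg (f : ℝ → ℝ → ℝ) (z : ℝ) : 0 ≤ angEnergy f z :=
  integral_nonneg fun _ => sq_nonneg _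

lemma one_div_le_wgt {z : ℝ} (hz : 0 < z) : 1 / z ≤ wgt z := by
  rw [wgt, div_le_div_iff₀ hz (by positivity)]
  nlinarith [mul_pos hz hz, mul_pos (mul_pos hz hz) hz]

lemma continuousOn_wgt {a b : ℝ} (ha : 0 < a) : ContinuousOn wgt (Icc a b) := by
  unfold wgt
  refine ContinuousOn.div (by fun_prop) (by fun_prop) fun z hz => ?_
  have := ha.trans_le hz.1
  positivity

lemma SupportedIn.exists_hasDerivAt_L12 {f : ℝ → ℝ → ℝ} {a b : ℝ} (hf : SupportedIn f a b)
    (hf0 : L12 f 0 = 0) :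
    ∃ L : ℝ → ℝ, (∀ z, HasDerivAt L (-(angMoment f z / z)) z) ∧ L a = 0 ∧ L b = 0 ∧
      ∀ z ≤ b, L12 f z = L z := by
  have hF : Continuous (angMoment f) :=
    continuous_integral_mul continuous_Kker.integrableOn_Icc hf.smooth.continuous
  have hF0 : ∀ r, r ∉ Ioo a b → angMoment f r = 0 := by
    intro r hr
    simp [angMoment, hf.eq_zero r _ hr]
  have hquot : (fun r => angMoment f r / r) = fun r => angMoment f r / max r a := by
    funext r
    rcases le_total r a with h | h
    · simp [hF0 r fun h' => absurd h'.1 h.not_gt]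
    · rw [max_eq_left h]
  have hc : Continuous fun r => angMoment f r / r := by
    rw [hquot]
    exact hF.div (continuous_id.max continuous_const) fun r =>
      (hf.pos.trans_le (le_max_right r a)).ne'
  have hL12 : ∀ z ≤ b, L12 f z = ∫ r in z..b, angMoment f r / r := by
    intro z hz
    have hin : ∀ r, ∫ θ in Icc 0 (π / 2), f r θ * Kker θ / r = angMoment f r / r := by
      intro r
      rw [integral_div, angMoment]
      simp only [mul_comm]
    rw [L12, intervalIntegral.integral_of_le hz]
    simp only [hin]
    refine setIntegral_eq_of_subset_of_forall_sdiff_eq_zero measurableSet_Ioi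
      (fun r hr => hr.1) fun r hr => ?_
    rw [hF0 r fun h => hr.2 ⟨hr.1, h.2.le⟩, zero_div]
  refine ⟨fun z => ∫ r in z..b, angMoment f r / r, fun z => ?_, ?_, by simp, hL12⟩
  · exact intervalIntegral.integral_hasDerivAt_left (hc.intervalIntegrable _ _)
      (hc.stronglyMeasurableAtFilter _ _) hc.continuousAt
  · have h1 := hL12 0 (hf.pos.le.trans hf.lt.le)
    rw [hf0, ← intervalIntegral.integral_add_adjacent_intervals (b := a)
      (hc.intervalIntegrable _ _) (hc.intervalIntegrable _ _)] at h1
    have h2 : ∫ r in (0 : ℝ)..a, angMoment f r / r = 0 := by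
      rw [intervalIntegral.integral_congr (g := fun _ => (0 : ℝ))]
      · simp
      · intro r hr
        rw [uIcc_of_le hf.pos.le] at hr
        simp [hF0 r fun h => absurd h.1 hr.2.not_gt]
    simp only
    linarith

lemma SupportedIn.integral_sq_L12_le {f : ℝ → ℝ → ℝ} {a b : ℝ} (hf : SupportedIn f a b)
    (hf0 : L12 f 0 = 0) :
    ∫ z in a..b, (L12 f z / z) ^ 2 ≤ 72 * ∫ z in a..b, wgt z ^ 2 * angEnergy f z := by
  obtain ⟨L, hL, hLa, hLb, heq⟩ := hf.exists_hasDerivAt_L12 hf0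
  have hF : Continuous (angMoment f) :=
    continuous_integral_mul continuous_Kker.integrableOn_Icc hf.smooth.continuous
  have h1 := hardy_inequality hf.pos hf.lt.le hF (fun z _ => hL z) hLa hLb
  have h2 : ∫ z in a..b, (L12 f z / z) ^ 2 = ∫ z in a..b, (L z / z) ^ 2 := by
    refine intervalIntegral.integral_congr fun z hz => ?_
    rw [uIcc_of_le hf.lt.le] at hz
    simp only [heq z hz.2]
  have hne : ∀ z ∈ Icc a b, z ≠ 0 := fun z hz => (hf.pos.trans_le hz.1).ne'
  have h3 : ∫ z in a..b, (angMoment f z / z) ^ 2 ≤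
      ∫ z in a..b, 18 * (wgt z ^ 2 * angEnergy f z) := by
    refine intervalIntegral.integral_mono_on hf.lt.le ?_ ?_ fun z hz => ?_
    · exact ContinuousOn.intervalIntegrable (by
        rw [uIcc_of_le hf.lt.le]; exact (hF.continuousOn.div continuousOn_id hne).pow 2)
    · exact ContinuousOn.intervalIntegrable (by
        rw [uIcc_of_le hf.lt.le]
        exact continuousOn_const.mul (((continuousOn_wgt hf.pos).pow 2).mul
          (continuous_angEnergy hf.smooth.continuous).continuousOn))
    · have hz0 := hf.pos.trans_le hz.1
      have hm : angMoment f z ^ 2 ≤ 2 * 9 * angEnergy f z :=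
        sq_integral_mul_le_of_bound continuous_Kker
          (hf.smooth.continuous.comp (continuous_const.prodMk continuous_id)) Kker_sq_le
      have he := angEnergy_nonneg f z
      calc (angMoment f z / z) ^ 2 = (1 / z) ^ 2 * angMoment f z ^ 2 := by ring
        _ ≤ wgt z ^ 2 * (2 * 9 * angEnergy f z) := by
            gcongr
            exact one_div_le_wgt hz0
        _ = _ := by ring
  rw [intervalIntegral.integral_const_mul] at h3
  linarith

/-- The derivative of `sin(2θ) K(θ)`. -/
def derivSinKker (θ : ℝ) : ℝ := 12 * sin θ * cos θ ^ 4 - 18 * sin θ ^ 3 * cos θ ^ 2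

lemma hasDerivAt_sin_mul_Kker (θ : ℝ) :
    HasDerivAt (fun t => 6 * sin t ^ 2 * cos t ^ 3) (derivSinKker θ) θ := by
  refine ((((hasDerivAt_sin θ).pow 2).const_mul 6).mul
    ((hasDerivAt_cos θ).pow 3)).congr_deriv ?_
  simp only [derivSinKker, Pi.pow_apply]
  push_cast
  ring

lemma derivSinKker_sq_le (θ : ℝ) : derivSinKker θ ^ 2 ≤ 324 := by
  have hsc := sin_sq_add_cos_sq θ
  have hc : cos θ ^ 2 ≤ 1 := cos_sq_le_one θ
  have hs : sin θ ^ 2 ≤ 1 := sin_sq_le_one θ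
  have h : (2 * cos θ ^ 2 - 3 * sin θ ^ 2) ^ 2 ≤ 9 := by
    nlinarith [sq_nonneg (sin θ), sq_nonneg (cos θ)]
  calc derivSinKker θ ^ 2 = 36 * (sin θ ^ 2 * (cos θ ^ 2 * cos θ ^ 2)) *
        (2 * cos θ ^ 2 - 3 * sin θ ^ 2) ^ 2 := by rw [derivSinKker]; ring
    _ ≤ 36 * (1 * (1 * 1)) * 9 := by gcongr
    _ = 324 := by norm_num

lemma integral_sin_mul_Kker_partialTh {f : ℝ → ℝ → ℝ}
    (hf : ContDiff ℝ (⊤ : ℕ∞) (Function.uncurry f)) (z : ℝ) :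
    ∫ θ in Icc 0 (π / 2), sin (2 * θ) * partialTh f z θ * Kker θ =
      -∫ θ in Icc 0 (π / 2), derivSinKker θ * f z θ := by
  have hfz : Continuous fun θ => f z θ := hf.continuous.comp (continuous_const.prodMk continuous_id)
  have hpz : Continuous fun θ => partialTh f z θ :=
    (contDiff_partialTh hf).continuous.comp (continuous_const.prodMk continuous_id)
  have hdc : Continuous derivSinKker := by unfold derivSinKker; fun_prop
  have c1 : Continuous fun θ => sin (2 * θ) * partialTh f z θ * Kker θ := by
    have := continuous_Kker
    fun_prop
  have c2 : Continuous fun θ => derivSinKker θ * f z θ := by fun_prop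
  have h := integral_Icc_eq_sub (F := fun θ => 6 * sin θ ^ 2 * cos θ ^ 3 * f z θ)
    (F' := fun θ => sin (2 * θ) * partialTh f z θ * Kker θ + derivSinKker θ * f z θ)
    (by fun_prop) (fun θ _ => ?_) (c1.add c2).integrableOn_Icc
  · rw [integral_add c1.integrableOn_Icc c2.integrableOn_Icc] at h
    simp at h
    linarith
  · refine ((hasDerivAt_sin_mul_Kker θ).mul (hasDerivAt_partialTh hf z θ)).congr_deriv ?_
    rw [sin_two_mul, Kker]
    ring

lemma integral_one_div_one_add_sq_le {a b : ℝ} (ha : 0 < a) (hab : a ≤ b) :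
    IntervalIntegrable (fun z : ℝ => 1 / (1 + z) ^ 2) volume a b ∧
      ∫ z in a..b, 1 / (1 + z) ^ 2 ≤ 1 := by
  have hpos : ∀ z ∈ Icc a b, 0 < 1 + z := fun z hz => by linarith [hz.1]
  have hi : IntervalIntegrable (fun z : ℝ => 1 / (1 + z) ^ 2) volume a b := by
    refine ContinuousOn.intervalIntegrable ?_
    rw [uIcc_of_le hab]
    exact ContinuousOn.div (by fun_prop) (by fun_prop) fun z hz => pow_ne_zero 2 (hpos z hz).ne'
  refine ⟨hi, ?_⟩
  rw [intervalIntegral.integral_eq_sub_of_hasDerivAt (f := fun z => -(1 / (1 + z))) _ hi]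
  · have h3 : 1 / (1 + a) ≤ 1 := div_le_self zero_le_one (by linarith)
    have h4 : 0 ≤ 1 / (1 + b) := (one_div_pos.2 (hpos b ⟨hab, le_rfl⟩)).le
    linarith
  · intro z hz
    rw [uIcc_of_le hab] at hz
    have := hpos z hz
    refine (((hasDerivAt_const z (1 : ℝ)).div ((hasDerivAt_id z).const_add 1)
      this.ne').neg).congr_deriv ?_
    simp only [id]
    field_simp
    ring

lemma SupportedIn.sq_L12_Dth_le {f : ℝ → ℝ → ℝ} {a b : ℝ} (hf : SupportedIn f a b) :
    L12 (fun z θ => 3 / (1 + z) * Dth f z θ) 0 ^ 2 ≤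
      5832 * ∫ z in a..b, wgt z ^ 2 * angEnergy f z := by
  have hdc : Continuous derivSinKker := by unfold derivSinKker; fun_prop
  set G : ℝ → ℝ := fun z => ∫ θ in Icc 0 (π / 2), derivSinKker θ * f z θ with hGdef
  have hG : Continuous G := continuous_integral_mul hdc.integrableOn_Icc hf.smooth.continuous
  have hG0 : ∀ z, z ∉ Ioo a b → G z = 0 := fun z hz => by simp [hGdef, hf.eq_zero z _ hz]
  have hpos : ∀ z ∈ Icc a b, 0 < z := fun z hz => hf.pos.trans_le hz.1
  have hX : L12 (fun z θ => 3 / (1 + z) * Dth f z θ) 0 =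
      ∫ z in a..b, (wgt z * G z) * (-3 * z / (1 + z) ^ 3) := by
    have hin : ∀ r, ∫ θ in Icc 0 (π / 2), 3 / (1 + r) * Dth f r θ * Kker θ / r =
        3 / (1 + r) / r * -G r := by
      intro r
      rw [hGdef, ← integral_sin_mul_Kker_partialTh hf.smooth, ← integral_const_mul]
      congr 1
      funext θ
      rw [Dth_eq hf.smooth]
      ring
    rw [L12]
    simp only [hin]
    rw [setIntegral_Ioi_eq hf.pos.le hf.lt.le fun z hz => by rw [hG0 z hz]; ring]
    refine intervalIntegral.integral_congr fun z hz => ?_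
    rw [uIcc_of_le hf.lt.le] at hz
    have := hpos z hz
    simp only [wgt]
    field_simp
  have hw := continuousOn_wgt hf.pos (b := b)
  have hgc : ContinuousOn (fun z : ℝ => -3 * z / (1 + z) ^ 3) (Icc a b) :=
    ContinuousOn.div (by fun_prop) (by fun_prop) fun z hz => by
      have := hpos z hz; positivity
  have hcii : ∀ g : ℝ → ℝ, ContinuousOn g (Icc a b) → IntervalIntegrable g volume a b :=
    fun g hg => ContinuousOn.intervalIntegrable (by rwa [uIcc_of_le hf.lt.le])
  have i1 := hcii _ ((hw.mul hG.continuousOn).pow 2)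
  have i2 := hcii _ (hgc.pow 2)
  have i3 := hcii _ ((hw.mul hG.continuousOn).mul hgc)
  have hCS : (∫ z in a..b, (wgt z * G z) * (-3 * z / (1 + z) ^ 3)) ^ 2 ≤
      (∫ z in a..b, (wgt z * G z) ^ 2) * ∫ z in a..b, (-3 * z / (1 + z) ^ 3) ^ 2 := by
    simp only [intervalIntegral.integral_of_le hf.lt.le]
    exact sq_integral_mul_le i1.1 i2.1 i3.1
  have hA : ∫ z in a..b, (wgt z * G z) ^ 2 ≤ 648 * ∫ z in a..b, wgt z ^ 2 * angEnergy f z := by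
    rw [← intervalIntegral.integral_const_mul]
    refine intervalIntegral.integral_mono_on hf.lt.le i1 (hcii _ (continuousOn_const.mul
      ((hw.pow 2).mul (continuous_angEnergy hf.smooth.continuous).continuousOn))) fun z _ => ?_
    have hm : G z ^ 2 ≤ 2 * 324 * angEnergy f z :=
      sq_integral_mul_le_of_bound hdc
        (hf.smooth.continuous.comp (continuous_const.prodMk continuous_id)) derivSinKker_sq_le
    rw [mul_pow]
    nlinarith [mul_le_mul_of_nonneg_left hm (sq_nonneg (wgt z))]
  have hB : ∫ z in a..b, (-3 * z / (1 + z) ^ 3) ^ 2 ≤ 9 := by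
    obtain ⟨i4, h4⟩ := integral_one_div_one_add_sq_le hf.pos hf.lt.le
    have h1 : ∫ z in a..b, (-3 * z / (1 + z) ^ 3) ^ 2 ≤ ∫ z in a..b, 9 * (1 / (1 + z) ^ 2) := by
      refine intervalIntegral.integral_mono_on hf.lt.le i2 (i4.const_mul 9) fun z hz => ?_
      have := hpos z hz
      rw [div_pow, mul_one_div, div_le_div_iff₀ (by positivity) (by positivity)]
      have h2 : z ^ 2 ≤ (1 + z) ^ 4 := by nlinarith [sq_nonneg z, pow_pos this 3, pow_pos this 4]
      calc (-3 * z) ^ 2 * (1 + z) ^ 2 = 9 * (1 + z) ^ 2 * z ^ 2 := by ring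
        _ ≤ 9 * (1 + z) ^ 2 * (1 + z) ^ 4 := by gcongr
        _ = _ := by ring
    rw [intervalIntegral.integral_const_mul] at h1
    linarith
  have hA0 : 0 ≤ ∫ z in a..b, (wgt z * G z) ^ 2 :=
    intervalIntegral.integral_nonneg hf.lt.le fun z _ => sq_nonneg _
  rw [hX]
  calc _ ≤ _ := hCS
    _ ≤ (∫ z in a..b, (wgt z * G z) ^ 2) * 9 := by gcongr
    _ ≤ _ := by linarith

/-- The weighted angular energy `∫ sin(2θ)^{2-γ} (∂_θ f)²`. -/
def wtEnergy (α : ℝ) (f : ℝ → ℝ → ℝ) (z : ℝ) : ℝ :=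
  ∫ θ in Icc 0 (π / 2), angWeight α θ * partialTh f z θ ^ 2

/-- The weighted angular pairing of `∂_θ f` with `∂_z ∂_θ f`. -/
def radialPairing (α : ℝ) (f : ℝ → ℝ → ℝ) (z : ℝ) : ℝ :=
  ∫ θ in Icc 0 (π / 2), angWeight α θ * (partialTh f z θ * partialZ (partialTh f) z θ)

/-- The weighted angular pairing of `∂_θ f` with `∂_θ D_θ f`. -/
def angPairing (α : ℝ) (f : ℝ → ℝ → ℝ) (z : ℝ) : ℝ :=
  ∫ θ in Icc 0 (π / 2), angWeight α θ * (partialTh f z θ *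
    (2 * cos (2 * θ) * partialTh f z θ + sin (2 * θ) * partialTh (partialTh f) z θ))

/-- The weighted angular pairing of `∂_θ f` with `Γ'`. -/
def gamPairing (α : ℝ) (f : ℝ → ℝ → ℝ) (z : ℝ) : ℝ :=
  ∫ θ in Icc 0 (π / 2), angWeight α θ * derivGam α θ * partialTh f z θ

/-- The coefficient of `Γ` in `𝓛_Γ^T f`. -/
def gamCoeff (α : ℝ) (f : ℝ → ℝ → ℝ) (z : ℝ) : ℝ :=
  2 * z ^ 2 / (1 + z) ^ 3 / cGam α * L12 (fun z θ => 3 / (1 + z) * Dth f z θ) 0 -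
    2 * z / (cGam α * (1 + z) ^ 2) * L12 f z

lemma deriv_LGamT (α : ℝ) {f : ℝ → ℝ → ℝ} (hf : ContDiff ℝ (⊤ : ℕ∞) (Function.uncurry f))
    (z : ℝ) {θ : ℝ} (hθ : θ ∈ Ioo 0 (π / 2)) :
    deriv (fun t => LGamT α f z t) θ =
      partialTh f z θ + z * partialZ (partialTh f) z θ - 2 * partialTh f z θ / (1 + z) -
        3 / (1 + z) * (2 * cos (2 * θ) * partialTh f z θ +
          sin (2 * θ) * partialTh (partialTh f) z θ) + derivGam α θ * gamCoeff α f z := by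
  have e : (fun t => LGamT α f z t) = fun t => f z t + z * partialZ f z t - 2 * f z t / (1 + z) -
      3 / (1 + z) * (sin (2 * t) * partialTh f z t) + Gam α t * gamCoeff α f z := by
    funext t
    rw [LGamT, LGam, Lop, Pproj, gamCoeff, (hasDerivAt_partialZ hf z t).deriv, ← Dth_eq hf]
    ring
  rw [e]
  have h1 := hasDerivAt_partialTh hf z θ
  have h2 := hasDerivAt_partialTh (contDiff_partialZ hf) z θ
  rw [partialTh_partialZ hf] at h2
  have h3 := hasDerivAt_partialTh (contDiff_partialTh hf) z θ
  have h4 : HasDerivAt (fun t => sin (2 * t)) (cos (2 * θ) * (2 * 1)) θ :=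
    ((hasDerivAt_id θ).const_mul 2).sin
  refine HasDerivAt.deriv (((((h1.add (h2.const_mul z)).sub
    ((h1.const_mul 2).div_const (1 + z))).sub ((h4.mul h3).const_mul (3 / (1 + z)))).add
    ((hasDerivAt_Gam α hθ).mul_const _)).congr_deriv ?_)
  ring

lemma angWeight_eq (α : ℝ) {θ : ℝ} (hθ : θ ∈ Ioo 0 (π / 2)) :
    angWeight α θ = sin (2 * θ) ^ 2 / sin (2 * θ) ^ (1 + α / 10) := by
  have hs : 0 < sin (2 * θ) :=
    sin_pos_of_pos_of_lt_pi (by linarith [hθ.1]) (by linarith [hθ.2])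
  rw [angWeight, ← rpow_natCast, ← rpow_sub hs]
  congr 1
  push_cast
  ring

section Smooth

variable {α : ℝ} {f : ℝ → ℝ → ℝ}

lemma continuous_sq_partialTh (hf : ContDiff ℝ (⊤ : ℕ∞) (Function.uncurry f)) :
    Continuous (Function.uncurry fun z θ => partialTh f z θ ^ 2) := by
  have h1 : Continuous fun x : ℝ × ℝ => partialTh f x.1 x.2 := (contDiff_partialTh hf).continuous
  exact (by fun_prop : Continuous fun x : ℝ × ℝ => partialTh f x.1 x.2 ^ 2)

lemma continuous_wtEnergy (hα : α ≤ 1) (hf : ContDiff ℝ (⊤ : ℕ∞) (Function.uncurry f)) :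
    Continuous (wtEnergy α f) :=
  continuous_integral_mul (P := fun z θ => partialTh f z θ ^ 2)
    (continuous_angWeight hα).integrableOn_Icc (continuous_sq_partialTh hf)

lemma continuous_radialPairing (hα : α ≤ 1) (hf : ContDiff ℝ (⊤ : ℕ∞) (Function.uncurry f)) :
    Continuous (radialPairing α f) := by
  have h1 := (contDiff_partialTh hf).continuous
  have h2 := (contDiff_partialZ (contDiff_partialTh hf)).continuous
  exact continuous_integral_mul (P := fun z θ => partialTh f z θ * partialZ (partialTh f) z θ)
    (continuous_angWeight hα).integrableOn_Icc (h1.mul h2)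

lemma continuous_angPairing_integrand (hf : ContDiff ℝ (⊤ : ℕ∞) (Function.uncurry f)) :
    Continuous fun x : ℝ × ℝ => partialTh f x.1 x.2 * (2 * cos (2 * x.2) * partialTh f x.1 x.2 +
      sin (2 * x.2) * partialTh (partialTh f) x.1 x.2) := by
  have h1 : Continuous fun x : ℝ × ℝ => partialTh f x.1 x.2 := (contDiff_partialTh hf).continuous
  have h2 : Continuous fun x : ℝ × ℝ => partialTh (partialTh f) x.1 x.2 :=
    (contDiff_partialTh (contDiff_partialTh hf)).continuous
  fun_prop

lemma continuous_angPairing (hα : α ≤ 1) (hf : ContDiff ℝ (⊤ : ℕ∞) (Function.uncurry f)) :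
    Continuous (angPairing α f) :=
  continuous_integral_mul (P := fun z θ => partialTh f z θ *
    (2 * cos (2 * θ) * partialTh f z θ + sin (2 * θ) * partialTh (partialTh f) z θ))
    (continuous_angWeight hα).integrableOn_Icc (continuous_angPairing_integrand hf)

lemma continuous_gamPairing (hα : α ∈ Ioc (0 : ℝ) 1)
    (hf : ContDiff ℝ (⊤ : ℕ∞) (Function.uncurry f)) : Continuous (gamPairing α f) :=
  continuous_integral_mul (integrableOn_angWeight_mul_derivGam hα) (contDiff_partialTh hf).continuous

lemma wtEnergy_nonneg (α : ℝ) (f : ℝ → ℝ → ℝ) (z : ℝ) : 0 ≤ wtEnergy α f z :=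
  setIntegral_nonneg measurableSet_Icc fun _ hθ =>
    mul_nonneg (angWeight_nonneg α hθ) (sq_nonneg _)

lemma hasDerivAt_wtEnergy (hα : α ≤ 1) (hf : ContDiff ℝ (⊤ : ℕ∞) (Function.uncurry f)) (z : ℝ) :
    HasDerivAt (wtEnergy α f) (2 * radialPairing α f z) z := by
  have hp := contDiff_partialTh hf
  have hp2 : ContDiff ℝ (⊤ : ℕ∞) (Function.uncurry fun z θ => partialTh f z θ ^ 2) :=
    ContDiff.pow (show ContDiff ℝ (⊤ : ℕ∞) fun x : ℝ × ℝ => partialTh f x.1 x.2 from hp) 2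
  refine (hasDerivAt_integral_mul (continuous_angWeight hα).integrableOn_Icc hp2 z).congr_deriv ?_
  rw [radialPairing, ← integral_const_mul]
  congr 1
  funext θ
  have h := (hasDerivAt_partialZ hp2 z θ).unique ((hasDerivAt_partialZ hp z θ).pow 2)
  rw [h]
  push_cast
  ring

lemma angPairing_le (hα : α ∈ Ioc (0 : ℝ) 1) (hf : ContDiff ℝ (⊤ : ℕ∞) (Function.uncurry f))
    (z : ℝ) : angPairing α f z ≤ α / 10 * wtEnergy α f z := by
  have hp : Continuous fun θ => partialTh f z θ :=
    (contDiff_partialTh hf).continuous.comp (continuous_const.prodMk continuous_id)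
  have hr : Continuous fun θ => partialTh (partialTh f) z θ :=
    (contDiff_partialTh (contDiff_partialTh hf)).continuous.comp
      (continuous_const.prodMk continuous_id)
  have hh := continuous_angWeight hα.2
  have ip1 : IntegrableOn (fun θ => angWeight α θ * partialTh f z θ ^ 2) (Icc 0 (π / 2)) :=
    (by fun_prop : Continuous _).integrableOn_Icc
  have ip2 : IntegrableOn (fun θ => angWeight α θ * (partialTh f z θ *
      (2 * cos (2 * θ) * partialTh f z θ + sin (2 * θ) * partialTh (partialTh f) z θ)))
      (Icc 0 (π / 2)) := (by fun_prop : Continuous _).integrableOn_Icc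
  have ip3 : IntegrableOn (fun θ => angWeight α θ * (partialTh f z θ *
      (2 * cos (2 * θ) * partialTh f z θ + sin (2 * θ) * partialTh (partialTh f) z θ)) -
      α / 10 * cos (2 * θ) * (angWeight α θ * partialTh f z θ ^ 2)) (Icc 0 (π / 2)) :=
    (by fun_prop : Continuous _).integrableOn_Icc
  have hexp : (2 : ℝ) - α / 10 ≠ 0 := by linarith [hα.2]
  have h0 : ∫ θ in Icc 0 (π / 2), (angWeight α θ * (partialTh f z θ *
      (2 * cos (2 * θ) * partialTh f z θ + sin (2 * θ) * partialTh (partialTh f) z θ)) -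
      α / 10 * cos (2 * θ) * (angWeight α θ * partialTh f z θ ^ 2)) = 0 := by
    have hc : Continuous fun θ : ℝ => sin (2 * θ) ^ (2 - α / 10) :=
      (continuous_sin.comp (continuous_const.mul continuous_id)).rpow_const
        fun _ => Or.inr (by linarith [hα.2])
    rw [integral_Icc_eq_sub
      (F := fun θ => sin (2 * θ) ^ (2 - α / 10) * partialTh f z θ ^ 2 / 2) (by fun_prop) _ ip3]
    · have : 2 * (π / 2) = π := by ring
      simp [this, zero_rpow hexp]
    · intro θ hθ
      have hs : 0 < sin (2 * θ) :=
        sin_pos_of_pos_of_lt_pi (by linarith [hθ.1]) (by linarith [hθ.2])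
      have h4 : HasDerivAt (fun t => sin (2 * t)) (cos (2 * θ) * (2 * 1)) θ :=
        ((hasDerivAt_id θ).const_mul 2).sin
      refine (((h4.rpow_const (p := 2 - α / 10) (Or.inl hs.ne')).mul
        ((hasDerivAt_partialTh (contDiff_partialTh hf) z θ).pow 2)).div_const 2).congr_deriv ?_
      have e1 : sin (2 * θ) ^ (2 - α / 10) = sin (2 * θ) * angWeight α θ := by
        rw [angWeight, ← rpow_one_add' hs.le (by linarith [hα.2])]
        congr 1
        ring
      have e2 : sin (2 * θ) ^ (2 - α / 10 - 1) = angWeight α θ := by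
        rw [angWeight]
        congr 1
        ring
      simp only [Pi.pow_apply, e1, e2]
      push_cast
      ring
  have h1 : ∫ θ in Icc 0 (π / 2), (angWeight α θ * (partialTh f z θ *
      (2 * cos (2 * θ) * partialTh f z θ + sin (2 * θ) * partialTh (partialTh f) z θ)) -
      α / 10 * (angWeight α θ * partialTh f z θ ^ 2)) ≤ 0 := by
    refine (setIntegral_mono_on (ip2.sub (ip1.const_mul (α / 10))) ip3 measurableSet_Icc
      fun θ hθ => ?_).trans h0.le
    simp only [Pi.sub_apply]
    have hn : 0 ≤ α / 10 * (angWeight α θ * partialTh f z θ ^ 2) :=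
      mul_nonneg (by linarith [hα.1]) (mul_nonneg (angWeight_nonneg α hθ) (sq_nonneg _))
    nlinarith [cos_le_one (2 * θ)]
  rw [integral_sub ip2 (ip1.const_mul _), integral_const_mul] at h1
  rw [angPairing, wtEnergy]
  linarith

lemma gamPairing_mul_ge (hα : α ∈ Ioc (0 : ℝ) 1)
    (hf : ContDiff ℝ (⊤ : ℕ∞) (Function.uncurry f)) (z t : ℝ) :
    -(1 / 4 * wtEnergy α f z) - 4 * α * t ^ 2 ≤ t * gamPairing α f z := by
  have hp := contDiff_partialTh hf
  have ip1 := integrable_mul_slice (P := fun z θ => partialTh f z θ ^ 2)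
    (continuous_angWeight hα.2).integrableOn_Icc
    (continuous_sq_partialTh hf) z
  have ip2 := integrableOn_angWeight_mul_derivGam_sq hα
  have ip3 := integrable_mul_slice (integrableOn_angWeight_mul_derivGam hα) hp.continuous z
  have h : 0 ≤ ∫ θ in Icc 0 (π / 2), (t * (angWeight α θ * derivGam α θ * partialTh f z θ) +
      (1 / 4 * (angWeight α θ * partialTh f z θ ^ 2) +
        t ^ 2 * (angWeight α θ * derivGam α θ ^ 2))) := by
    refine setIntegral_nonneg measurableSet_Icc fun θ hθ => ?_
    have : t * (angWeight α θ * derivGam α θ * partialTh f z θ) +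
      (1 / 4 * (angWeight α θ * partialTh f z θ ^ 2) +
        t ^ 2 * (angWeight α θ * derivGam α θ ^ 2)) =
        angWeight α θ * (partialTh f z θ / 2 + t * derivGam α θ) ^ 2 := by ring
    rw [this]
    exact mul_nonneg (angWeight_nonneg α hθ) (sq_nonneg _)
  have ip4 : IntegrableOn (fun θ => 1 / 4 * (angWeight α θ * partialTh f z θ ^ 2) +
      t ^ 2 * (angWeight α θ * derivGam α θ ^ 2)) (Icc 0 (π / 2)) :=
    (ip1.const_mul _).add (ip2.const_mul _)
  rw [integral_add (ip3.const_mul t) ip4, integral_add (ip1.const_mul _) (ip2.const_mul _),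
    integral_const_mul, integral_const_mul, integral_const_mul] at h
  have hm := mul_le_mul_of_nonneg_left (integral_angWeight_mul_derivGam_sq_le hα) (sq_nonneg t)
  rw [wtEnergy, gamPairing]
  linarith

lemma inner_integral_eq (hα : α ∈ Ioc (0 : ℝ) 1)
    (hf : ContDiff ℝ (⊤ : ℕ∞) (Function.uncurry f)) (z : ℝ) :
    ∫ θ in Icc 0 (π / 2), Dth (LGamT α f) z θ *
        (Dth f z θ * wgt z ^ 2 / sin (2 * θ) ^ (1 + α / 10)) =
      wgt z ^ 2 * ((1 - 2 / (1 + z)) * wtEnergy α f z + z * radialPairing α f z -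
        3 / (1 + z) * angPairing α f z + gamCoeff α f z * gamPairing α f z) := by
  have hp := contDiff_partialTh hf
  have hw := (continuous_angWeight hα.2).integrableOn_Icc (a := 0) (b := π / 2) (μ := volume)
  have ip1 := integrable_mul_slice (P := fun z θ => partialTh f z θ ^ 2) hw
    (continuous_sq_partialTh hf) z
  have ip2 := integrable_mul_slice
    (P := fun z θ => partialTh f z θ * partialZ (partialTh f) z θ) hw
    (hp.continuous.mul (contDiff_partialZ hp).continuous) z
  have ip3 := integrable_mul_slice (P := fun z θ => partialTh f z θ *
    (2 * cos (2 * θ) * partialTh f z θ + sin (2 * θ) * partialTh (partialTh f) z θ)) hw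
    (continuous_angPairing_integrand hf) z
  have ip4 := integrable_mul_slice (integrableOn_angWeight_mul_derivGam hα) hp.continuous z
  have ip12 := (ip1.const_mul (1 - 2 / (1 + z))).add (ip2.const_mul z)
  have ip123 := ip12.sub (ip3.const_mul (3 / (1 + z)))
  rw [wtEnergy, radialPairing, angPairing, gamPairing, ← integral_const_mul (1 - 2 / (1 + z)),
    ← integral_const_mul z, ← integral_const_mul (3 / (1 + z)),
    ← integral_const_mul (gamCoeff α f z),
    ← integral_add' (ip1.const_mul (1 - 2 / (1 + z))) (ip2.const_mul z),
    ← integral_sub' ip12 (ip3.const_mul (3 / (1 + z))),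
    ← integral_add' ip123 (ip4.const_mul (gamCoeff α f z)), ← integral_const_mul]
  refine integral_congr_ae ?_
  filter_upwards [ae_mem_Ioo] with θ hθ
  rw [Dth_eq hf, Dth, deriv_LGamT α hf z hθ]
  simp only [angWeight_eq α hθ, Pi.add_apply, Pi.sub_apply]
  ring

end Smooth

lemma hasDerivAt_wgt {z : ℝ} (hz : 0 < z) : HasDerivAt wgt (-(2 * wgt z / (z * (1 + z)))) z := by
  have h := (((hasDerivAt_id z).const_add 1).pow 2).div ((hasDerivAt_id z).pow 2)
    (by simp only [id, Pi.pow_apply]; positivity)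
  refine h.congr_deriv ?_
  simp only [wgt, id, Pi.pow_apply]
  push_cast
  field_simp
  ring

section Supported

variable {α : ℝ} {f : ℝ → ℝ → ℝ} {a b : ℝ}

lemma SupportedIn.continuousOn_gamCoeff (hf : SupportedIn f a b) (hf0 : L12 f 0 = 0)
    (hα : α ∈ Ioc (0 : ℝ) 1) : ContinuousOn (gamCoeff α f) (Icc a b) := by
  obtain ⟨L, hL, -, -, heq⟩ := hf.exists_hasDerivAt_L12 hf0
  have hc : 0 < cGam α := by linarith [cGam_ge hα]
  have hL12 : ContinuousOn (L12 f) (Icc a b) :=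
    ContinuousOn.congr (fun z _ => (hL z).continuousAt.continuousWithinAt) fun z hz => heq z hz.2
  have hpos : ∀ z ∈ Icc a b, 0 < z := fun z hz => hf.pos.trans_le hz.1
  unfold gamCoeff
  refine ContinuousOn.sub (ContinuousOn.mul (ContinuousOn.div_const (ContinuousOn.div
    (by fun_prop) (by fun_prop) fun z hz => ?_) _) continuousOn_const)
    (ContinuousOn.mul (ContinuousOn.div (by fun_prop) (by fun_prop) fun z hz => ?_) hL12)
  all_goals
    have := hpos z hz
    positivity

lemma SupportedIn.integral_sq_gamCoeff_le (hf : SupportedIn f a b) (hf0 : L12 f 0 = 0)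
    (hα : α ∈ Ioc (0 : ℝ) 1) :
    ∫ z in a..b, (wgt z * gamCoeff α f z) ^ 2 ≤
      1180800 * ∫ z in a..b, wgt z ^ 2 * angEnergy f z := by
  obtain ⟨L, hL, -, -, heq⟩ := hf.exists_hasDerivAt_L12 hf0
  have hc := cGam_ge hα
  have hL12 : ContinuousOn (L12 f) (Icc a b) :=
    ContinuousOn.congr (fun z _ => (hL z).continuousAt.continuousWithinAt) fun z hz => heq z hz.2
  have hpos : ∀ z ∈ Icc a b, 0 < z := fun z hz => hf.pos.trans_le hz.1
  have hcii : ∀ g : ℝ → ℝ, ContinuousOn g (Icc a b) → IntervalIntegrable g volume a b :=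
    fun g hg => ContinuousOn.intervalIntegrable (by rwa [uIcc_of_le hf.lt.le])
  have hX := hf.sq_L12_Dth_le
  have hLi := hf.integral_sq_L12_le hf0
  obtain ⟨i1, h1⟩ := integral_one_div_one_add_sq_le hf.pos hf.lt.le
  have i2 := hcii (fun z => (L12 f z / z) ^ 2) ((hL12.div continuousOn_id fun z hz => (hpos z hz).ne').pow 2)
  have i3 := hcii _ (((continuousOn_wgt hf.pos).mul (hf.continuousOn_gamCoeff hf0 hα)).pow 2)
  set X := L12 (fun z θ => 3 / (1 + z) * Dth f z θ) 0 with hXdef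
  have hle : ∫ z in a..b, (wgt z * gamCoeff α f z) ^ 2 ≤
      ∫ z in a..b, (200 * X ^ 2 * (1 / (1 + z) ^ 2) + 200 * (L12 f z / z) ^ 2) := by
    refine intervalIntegral.integral_mono_on hf.lt.le i3
      ((i1.const_mul _).add (i2.const_mul 200)) fun z hz => ?_
    have hz0 := hpos z hz
    have hc0 : 0 < cGam α := by linarith
    have e : wgt z * gamCoeff α f z = (X / (1 + z) - L12 f z / z) * (2 / cGam α) := by
      rw [gamCoeff, wgt, ← hXdef]
      field_simp
    have hq : (2 / cGam α) ^ 2 ≤ 10 ^ 2 := by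
      gcongr
      rw [div_le_iff₀ hc0]
      linarith
    calc (wgt z * gamCoeff α f z) ^ 2
        = (X / (1 + z) - L12 f z / z) ^ 2 * (2 / cGam α) ^ 2 := by rw [e, mul_pow]
      _ ≤ (X / (1 + z) - L12 f z / z) ^ 2 * 10 ^ 2 := by gcongr
      _ ≤ 200 * (X / (1 + z)) ^ 2 + 200 * (L12 f z / z) ^ 2 := by
          nlinarith [sq_nonneg (X / (1 + z) + L12 f z / z)]
      _ = _ := by rw [div_pow X]; ring
  rw [intervalIntegral.integral_add (i1.const_mul _) (i2.const_mul 200),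
    intervalIntegral.integral_const_mul, intervalIntegral.integral_const_mul] at hle
  have := mul_le_mul_of_nonneg_left h1 (sq_nonneg X)
  linarith

lemma SupportedIn.ip_wgt_eq (hf : SupportedIn f a b) :
    ip (fun z θ => f z θ * wgt z) (fun z θ => f z θ * wgt z) =
      ∫ z in a..b, wgt z ^ 2 * angEnergy f z := by
  have hin : ∀ z, ∫ θ in Icc 0 (π / 2), f z θ * wgt z * (f z θ * wgt z) =
      wgt z ^ 2 * angEnergy f z := by
    intro z
    rw [angEnergy, ← integral_const_mul]
    congr 1
    funext θ
    ring
  simp only [ip, hin]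
  exact setIntegral_Ioi_eq hf.pos.le hf.lt.le fun z hz => by
    simp [angEnergy, hf.eq_zero z _ hz]

lemma SupportedIn.ip_Dth_wgt_eq (hf : SupportedIn f a b) :
    ip (fun z θ => Dth f z θ * wgt z / sin (2 * θ) ^ ((1 + α / 10) / 2))
        (fun z θ => Dth f z θ * wgt z / sin (2 * θ) ^ ((1 + α / 10) / 2)) =
      ∫ z in a..b, wgt z ^ 2 * wtEnergy α f z := by
  have hin : ∀ z, ∫ θ in Icc 0 (π / 2), Dth f z θ * wgt z / sin (2 * θ) ^ ((1 + α / 10) / 2) *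
      (Dth f z θ * wgt z / sin (2 * θ) ^ ((1 + α / 10) / 2)) = wgt z ^ 2 * wtEnergy α f z := by
    intro z
    rw [wtEnergy, ← integral_const_mul]
    refine integral_congr_ae ?_
    filter_upwards [ae_mem_Ioo] with θ hθ
    have hs : 0 < sin (2 * θ) :=
      sin_pos_of_pos_of_lt_pi (by linarith [hθ.1]) (by linarith [hθ.2])
    have e : sin (2 * θ) ^ (1 + α / 10) =
        sin (2 * θ) ^ ((1 + α / 10) / 2) * sin (2 * θ) ^ ((1 + α / 10) / 2) := by
      rw [← rpow_add hs, add_halves]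
    rw [Dth_eq hf.smooth, angWeight_eq α hθ, e]
    ring
  simp only [ip, hin]
  exact setIntegral_Ioi_eq hf.pos.le hf.lt.le fun z hz => by
    simp [wtEnergy, hf.partialTh_eq_zero hz]

lemma SupportedIn.ip_Dth_LGamT_eq (hf : SupportedIn f a b) (hα : α ∈ Ioc (0 : ℝ) 1) :
    ip (Dth (LGamT α f)) (fun z θ => Dth f z θ * wgt z ^ 2 / sin (2 * θ) ^ (1 + α / 10)) =
      ∫ z in a..b, wgt z ^ 2 * ((1 - 2 / (1 + z)) * wtEnergy α f z + z * radialPairing α f z -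
        3 / (1 + z) * angPairing α f z + gamCoeff α f z * gamPairing α f z) := by
  simp only [ip, inner_integral_eq hα hf.smooth]
  exact setIntegral_Ioi_eq hf.pos.le hf.lt.le fun z hz => by
    simp [wtEnergy, radialPairing, angPairing, gamPairing, hf.partialTh_eq_zero hz]

end Supported

/-- The derivative of `z w² E / 2`, where `E` is the weighted angular energy. -/
def derivWtEnergy (α : ℝ) (f : ℝ → ℝ → ℝ) (z : ℝ) : ℝ :=
  wgt z ^ 2 * ((1 / 2 - 2 / (1 + z)) * wtEnergy α f z + z * radialPairing α f z)

lemma SupportedIn.integral_derivWtEnergy {α : ℝ} {f : ℝ → ℝ → ℝ} {a b : ℝ}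
    (hf : SupportedIn f a b) (hα : α ≤ 1)
    (hi : IntervalIntegrable (derivWtEnergy α f) volume a b) :
    ∫ z in a..b, derivWtEnergy α f z = 0 := by
  have h0 : ∀ z, z ∉ Ioo a b → wtEnergy α f z = 0 := fun z hz => by
    simp [wtEnergy, hf.partialTh_eq_zero hz]
  rw [intervalIntegral.integral_eq_sub_of_hasDerivAt
    (f := fun z => z * wgt z ^ 2 * wtEnergy α f z / 2) _ hi]
  · simp [h0 a fun h => lt_irrefl _ h.1, h0 b fun h => lt_irrefl _ h.2]
  · intro z hz
    rw [uIcc_of_le hf.lt.le] at hz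
    have hz0 := hf.pos.trans_le hz.1
    refine ((((hasDerivAt_id z).mul ((hasDerivAt_wgt hz0).pow 2)).mul
      (hasDerivAt_wtEnergy hα hf.smooth z)).div_const 2).congr_deriv ?_
    simp only [derivWtEnergy, id, Pi.mul_apply, Pi.pow_apply]
    push_cast
    field_simp
    ring

/-- Coercivity of `𝓛_Γ^T` with one angular derivative: for `α ∈ (0,1]`, `γ = 1 + α/10`,
and admissible `f` with `L₁₂(f)(0) = 0`,
`(D_θ(𝓛_Γ^T(f)), (D_θ f)·w²/sin(2θ)^γ) ≥ (1/4 − α)‖(D_θ f)·w/sin(2θ)^{γ/2}‖² − 10⁷ α ‖f·w‖²`. -/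
theorem LGamT_coercive_theta (α : ℝ) (hα : α ∈ Ioc (0 : ℝ) 1)
    (γ : ℝ) (hγ : γ = 1 + α / 10)
    (f : ℝ → ℝ → ℝ) (hf : Admissible f) (hf0 : L12 f 0 = 0) :
    ip (Dth (LGamT α f))
        (fun z θ => Dth f z θ * wgt z ^ 2 / Real.sin (2 * θ) ^ γ) ≥
      (1 / 4 - α) *
          ip (fun z θ => Dth f z θ * wgt z / Real.sin (2 * θ) ^ (γ / 2))
            (fun z θ => Dth f z θ * wgt z / Real.sin (2 * θ) ^ (γ / 2)) -
        10 ^ 7 * α * ip (fun z θ => f z θ * wgt z) (fun z θ => f z θ * wgt z) := by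
  subst hγ
  obtain ⟨a, b, hs⟩ := hf.exists_supportedIn
  rw [hs.ip_Dth_LGamT_eq hα, hs.ip_Dth_wgt_eq, hs.ip_wgt_eq]
  have hab := hs.lt.le
  have hpos : ∀ z ∈ Icc a b, 0 < z := fun z hz => hs.pos.trans_le hz.1
  have hcii : ∀ g : ℝ → ℝ, ContinuousOn g (Icc a b) → IntervalIntegrable g volume a b :=
    fun g hg => ContinuousOn.intervalIntegrable (by rwa [uIcc_of_le hab])
  have cw := continuousOn_wgt hs.pos (b := b)
  have cE := (continuous_wtEnergy hα.2 hs.smooth).continuousOn (s := Icc a b)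
  have cR := (continuous_radialPairing hα.2 hs.smooth).continuousOn (s := Icc a b)
  have cA := (continuous_angPairing hα.2 hs.smooth).continuousOn (s := Icc a b)
  have cG := (continuous_gamPairing hα hs.smooth).continuousOn (s := Icc a b)
  have cC := hs.continuousOn_gamCoeff hf0 hα
  have cd : ∀ k : ℝ, ContinuousOn (fun z : ℝ => k / (1 + z)) (Icc a b) := fun k =>
    ContinuousOn.div (by fun_prop) (by fun_prop) fun z hz => by
      have := hpos z hz
      positivity
  have cd2 := cd 2
  have cd3 := cd 3
  have iE := hcii (fun z => wgt z ^ 2 * wtEnergy α f z) (by fun_prop)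
  have iC := hcii (fun z => (wgt z * gamCoeff α f z) ^ 2) (by fun_prop)
  have iD : IntervalIntegrable (derivWtEnergy α f) volume a b :=
    hcii _ (by unfold derivWtEnergy; fun_prop)
  have iJ := hcii (fun z => wgt z ^ 2 * ((1 - 2 / (1 + z)) * wtEnergy α f z +
    z * radialPairing α f z - 3 / (1 + z) * angPairing α f z +
      gamCoeff α f z * gamPairing α f z)) (by fun_prop)
  have hlow := intervalIntegral.integral_mono_on hab
    (((iE.const_mul (1 / 4 - α)).add iD).sub (iC.const_mul (4 * α))) iJ fun z hz => by
      have hz0 := hpos z hz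
      have hE := wtEnergy_nonneg α f z
      have hA : 3 / (1 + z) * angPairing α f z ≤ α * wtEnergy α f z := by
        calc 3 / (1 + z) * angPairing α f z ≤ 3 / (1 + z) * (α / 10 * wtEnergy α f z) := by
              gcongr
              exact angPairing_le hα hs.smooth z
          _ ≤ 3 * (α / 10 * wtEnergy α f z) := by
              have := hα.1
              gcongr
              exact div_le_self (by norm_num) (by linarith)
          _ ≤ α * wtEnergy α f z := by nlinarith [mul_nonneg hα.1.le hE]
      have hG := gamPairing_mul_ge hα hs.smooth z (gamCoeff α f z)
      have hsum : (1 / 4 - α) * wtEnergy α f z + ((1 / 2 - 2 / (1 + z)) * wtEnergy α f z +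
          z * radialPairing α f z) - 4 * α * gamCoeff α f z ^ 2 ≤
          (1 - 2 / (1 + z)) * wtEnergy α f z + z * radialPairing α f z -
            3 / (1 + z) * angPairing α f z + gamCoeff α f z * gamPairing α f z := by
        linarith
      have hmul := mul_le_mul_of_nonneg_left hsum (sq_nonneg (wgt z))
      rw [derivWtEnergy]
      linarith
  rw [intervalIntegral.integral_sub ((iE.const_mul _).add iD) (iC.const_mul _),
    intervalIntegral.integral_add (iE.const_mul _) iD, intervalIntegral.integral_const_mul,
    intervalIntegral.integral_const_mul, hs.integral_derivWtEnergy hα.2 iD] at hlow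
  have hC := mul_le_mul_of_nonneg_left (hs.integral_sq_gamCoeff_le hf0 hα)
    (by linarith [hα.1] : 0 ≤ 4 * α)
  have hW : 0 ≤ α * ∫ z in a..b, wgt z ^ 2 * angEnergy f z :=
    mul_nonneg hα.1.le (intervalIntegral.integral_nonneg hab fun z _ =>
      mul_nonneg (sq_nonneg _) (angEnergy_nonneg f z))
  linarith
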